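/- Let N ≥ 1, M ≥ 2, and let Ω₁, …, Ω_M ⊂ ℝ^N be nonempty bounded open sets whose closures are pairwise disjoint; set Ω := Ω₁ ∪ ⋯ ∪ Ω_M. Let μ⁻ be a finite nonnegative Borel measure on [0,1] such that μ⁻((0,s̄)) > 0 and μ⁻([s̄,1]) = 0 for some s̄ ∈ (0,1). Call u admissible if u ∈ A(Ω), ∫_Ω |∇u(x)|² dx < ∞ and 0 < ∫_{[0,s̄)} [u]_s² dμ⁻(s) < ∞, and for admissible u set R(u) := (∫_Ω |∇u(x)|² dx) / (∫_{[0,s̄)} [u]_s² dμ⁻(s)). If u is admissible and R(u) ≤ R(v) for every admissible v, then u takes both strictly positive and strictly negative values. -/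

import Mathlib

open MeasureTheory Filter Topology
open scoped ENNReal

noncomputable def cNs (N : ℕ) (s : ℝ) : ℝ :=
  (2 ^ (2 * s - 1) * Real.Gamma ((N + 2 * s) / 2) * (s * (1 - s))) /
    (Real.pi ^ ((N : ℝ) / 2) * Real.Gamma (2 - s))

/-- Squared Gagliardo seminorm `[u]_s²`, with the convention `[u]_0 = ‖u‖_{L²}`. -/
noncomputable def gagSq (N : ℕ) (u : EuclideanSpace ℝ (Fin N) → ℝ) (s : ℝ) : ℝ≥0∞ :=
  if s = 0 then ∫⁻ x, ENNReal.ofReal (u x ^ 2)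
  else ENNReal.ofReal (cNs N s) *
    ∫⁻ x, ∫⁻ y, ENNReal.ofReal ((u x - u y) ^ 2 / ‖x - y‖ ^ ((N : ℝ) + 2 * s))

/-- `A(U)`: continuous on `ℝ^N`, continuously differentiable on `U`, zero outside `U`. -/
def memA (N : ℕ) (U : Set (EuclideanSpace ℝ (Fin N))) (u : EuclideanSpace ℝ (Fin N) → ℝ) : Prop :=
  Continuous u ∧ ContDiffOn ℝ 1 u U ∧ ∀ x ∉ U, u x = 0

/-- The denominator `∫_{[0,s̄)} [u]_s² dμ⁻(s)`. -/
noncomputable def denom (N : ℕ) (μm : Measure ℝ) (sb : ℝ)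
    (u : EuclideanSpace ℝ (Fin N) → ℝ) : ℝ≥0∞ :=
  ∫⁻ s in Set.Ico (0 : ℝ) sb, gagSq N u s ∂μm

/-- Admissibility for the Rayleigh quotient. -/
def admissible (N : ℕ) (μm : Measure ℝ) (sb : ℝ) (U : Set (EuclideanSpace ℝ (Fin N)))
    (u : EuclideanSpace ℝ (Fin N) → ℝ) : Prop :=
  memA N U u ∧ IntegrableOn (fun x => ‖fderiv ℝ u x‖ ^ 2) U volume ∧
    0 < denom N μm sb u ∧ denom N μm sb u < ⊤

/-- The Rayleigh quotient `R(u)`. -/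
noncomputable def rayleigh (N : ℕ) (μm : Measure ℝ) (sb : ℝ)
    (U : Set (EuclideanSpace ℝ (Fin N))) (u : EuclideanSpace ℝ (Fin N) → ℝ) : ℝ :=
  (∫ x in U, ‖fderiv ℝ u x‖ ^ 2) / (denom N μm sb u).toReal

lemma cNs_pos {N : ℕ} {s : ℝ} (hs : s ∈ Set.Ioo (0 : ℝ) 1) : 0 < cNs N s := by
  have h0 := hs.1
  have h1 := hs.2
  have hN : (0 : ℝ) ≤ N := Nat.cast_nonneg N
  have hG1 : 0 < Real.Gamma ((N + 2 * s) / 2) := Real.Gamma_pos_of_pos (by linarith)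
  have hG2 : 0 < Real.Gamma (2 - s) := Real.Gamma_pos_of_pos (by linarith)
  have h2 : 0 < 1 - s := by linarith
  unfold cNs
  have := Real.pi_pos
  positivity

lemma continuousOn_cNs {N : ℕ} (hN : 1 ≤ N) : ContinuousOn (cNs N) (Set.Icc 0 1) := by
  have hN' : (1 : ℝ) ≤ N := by exact_mod_cast hN
  have hG : ∀ x : ℝ, 0 < x → ContinuousAt Real.Gamma x := fun x hx =>
    (Real.differentiableAt_Gamma fun m h => by
      have : (0 : ℝ) ≤ m := Nat.cast_nonneg m
      linarith).continuousAt
  intro s hs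
  have h0 := hs.1
  have h1 := hs.2
  apply ContinuousAt.continuousWithinAt
  have e1 : ContinuousAt (fun s : ℝ => Real.Gamma ((N + 2 * s) / 2)) s :=
    ContinuousAt.comp (g := Real.Gamma) (hG _ (by linarith)) (by fun_prop)
  have e2 : ContinuousAt (fun s : ℝ => Real.Gamma (2 - s)) s :=
    ContinuousAt.comp (g := Real.Gamma) (hG _ (by linarith)) (by fun_prop)
  have e3 : ContinuousAt (fun s : ℝ => (2 : ℝ) ^ (2 * s - 1)) s :=
    (Real.continuous_const_rpow two_ne_zero).continuousAt.comp
      (f := fun s : ℝ => 2 * s - 1) (by fun_prop)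
  have e4 : ContinuousAt (fun s : ℝ => s * (1 - s)) s := by fun_prop
  refine ((e3.mul e1).mul e4).div (e2.const_mul (Real.pi ^ ((N : ℝ) / 2))) ?_
  have hG2 : 0 < Real.Gamma (2 - s) := Real.Gamma_pos_of_pos (by linarith)
  have := Real.pi_pos
  positivity

/-- The normalised integral of `F x y / |x - y|^(N + 2s)`. -/
noncomputable def kernelInt (N : ℕ)
    (F : EuclideanSpace ℝ (Fin N) → EuclideanSpace ℝ (Fin N) → ℝ) (s : ℝ) : ℝ≥0∞ :=
  ENNReal.ofReal (cNs N s) *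
    ∫⁻ x, ∫⁻ y, ENNReal.ofReal (F x y / ‖x - y‖ ^ ((N : ℝ) + 2 * s))

/-- The nonlocal interaction of two functions with disjoint supports, with value `0` at `s = 0`. -/
noncomputable def interaction (N : ℕ) (f g : EuclideanSpace ℝ (Fin N) → ℝ) (s : ℝ) : ℝ≥0∞ :=
  if s = 0 then 0 else kernelInt N (fun x y => 2 * (f x * g y + f y * g x)) s

section KernelIntegrals

variable {N : ℕ} {f g : EuclideanSpace ℝ (Fin N) → ℝ}
  {F G : EuclideanSpace ℝ (Fin N) → EuclideanSpace ℝ (Fin N) → ℝ}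

lemma gagSq_of_ne_zero {s : ℝ} (hs : s ≠ 0) :
    gagSq N f s = kernelInt N (fun x y => (f x - f y) ^ 2) s := by
  simp [gagSq, kernelInt, hs]

lemma gagSq_neg (s : ℝ) : gagSq N (-f) s = gagSq N f s := by
  have h : ∀ x y, (-f x - -f y) ^ 2 = (f x - f y) ^ 2 := fun x y => by ring
  simp only [gagSq, Pi.neg_apply, h, neg_sq]

lemma gagSq_zero_fun (s : ℝ) : gagSq N (fun _ => 0) s = 0 := by
  simp [gagSq]

lemma denom_neg {μm : Measure ℝ} {sb : ℝ} : denom N μm sb (-f) = denom N μm sb f := by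
  simp [denom, gagSq_neg]

lemma kernelInt_mono {s : ℝ} (h : ∀ x y, F x y ≤ G x y) :
    kernelInt N F s ≤ kernelInt N G s := by
  unfold kernelInt
  gcongr
  exact h _ _

lemma measurable_kernel
    (hF : Measurable fun p : EuclideanSpace ℝ (Fin N) × EuclideanSpace ℝ (Fin N) =>
      F p.1 p.2) (s : ℝ) :
    Measurable fun p : EuclideanSpace ℝ (Fin N) × EuclideanSpace ℝ (Fin N) =>
      ENNReal.ofReal (F p.1 p.2 / ‖p.1 - p.2‖ ^ ((N : ℝ) + 2 * s)) := by
  fun_prop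

lemma kernelInt_add
    (hF : Measurable fun p : EuclideanSpace ℝ (Fin N) × EuclideanSpace ℝ (Fin N) =>
      F p.1 p.2)
    (hF0 : ∀ x y, 0 ≤ F x y) (hG0 : ∀ x y, 0 ≤ G x y) (s : ℝ) :
    kernelInt N (fun x y => F x y + G x y) s = kernelInt N F s + kernelInt N G s := by
  unfold kernelInt
  have hk := measurable_kernel hF s
  rw [← mul_add, ← lintegral_add_left hk.lintegral_prod_right']
  congr 1
  refine lintegral_congr fun x => ?_
  have hkx : Measurable fun y => ENNReal.ofReal (F x y / ‖x - y‖ ^ ((N : ℝ) + 2 * s)) :=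
    hk.comp measurable_prodMk_left
  simp only
  rw [← lintegral_add_left hkx]
  refine lintegral_congr fun y => ?_
  rw [add_div, ENNReal.ofReal_add]
  · have := hF0 x y
    positivity
  · have := hG0 x y
    positivity

lemma kernelInt_const_mul
    (hF : Measurable fun p : EuclideanSpace ℝ (Fin N) × EuclideanSpace ℝ (Fin N) =>
      F p.1 p.2)
    {c : ℝ} (hc : 0 ≤ c) (s : ℝ) :
    kernelInt N (fun x y => c * F x y) s = ENNReal.ofReal c * kernelInt N F s := by
  unfold kernelInt
  have hk := measurable_kernel hF s
  rw [mul_left_comm, ← lintegral_const_mul _ hk.lintegral_prod_right']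
  congr 1
  refine lintegral_congr fun x => ?_
  have hkx : Measurable fun y => ENNReal.ofReal (F x y / ‖x - y‖ ^ ((N : ℝ) + 2 * s)) :=
    hk.comp measurable_prodMk_left
  simp only
  rw [← lintegral_const_mul _ hkx]
  refine lintegral_congr fun y => ?_
  rw [mul_div_assoc, ENNReal.ofReal_mul hc]

lemma aemeasurable_kernelInt (hN : 1 ≤ N) {μm : Measure ℝ} {sb : ℝ} (hsb : sb ≤ 1)
    (hF : Measurable fun p : EuclideanSpace ℝ (Fin N) × EuclideanSpace ℝ (Fin N) =>
      F p.1 p.2) :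
    AEMeasurable (kernelInt N F) (μm.restrict (Set.Ico 0 sb)) := by
  have hc : AEMeasurable (cNs N) (μm.restrict (Set.Ico 0 sb)) :=
    ((continuousOn_cNs hN).mono fun s hs => ⟨hs.1, hs.2.le.trans hsb⟩).aemeasurable
      measurableSet_Ico
  refine hc.ennreal_ofReal.mul (Measurable.aemeasurable ?_)
  have h1 : Measurable fun p : (ℝ × EuclideanSpace ℝ (Fin N)) × EuclideanSpace ℝ (Fin N) =>
      ENNReal.ofReal (F p.1.2 p.2 / ‖p.1.2 - p.2‖ ^ ((N : ℝ) + 2 * p.1.1)) := by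
    have : Measurable fun p : (ℝ × EuclideanSpace ℝ (Fin N)) × EuclideanSpace ℝ (Fin N) =>
        F p.1.2 p.2 := hF.comp
          (f := fun p : (ℝ × EuclideanSpace ℝ (Fin N)) × EuclideanSpace ℝ (Fin N) =>
            (p.1.2, p.2)) (by fun_prop)
    fun_prop
  exact h1.lintegral_prod_right'.lintegral_prod_right'

lemma aemeasurable_gagSq (hN : 1 ≤ N) {μm : Measure ℝ} {sb : ℝ} (hsb : sb ≤ 1)
    (hf : Continuous f) : AEMeasurable (gagSq N f) (μm.restrict (Set.Ico 0 sb)) := by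
  have h := aemeasurable_kernelInt hN (μm := μm) hsb (F := fun x y => (f x - f y) ^ 2)
    (by fun_prop)
  have : gagSq N f = Set.indicator {0} (fun _ => ∫⁻ x, ENNReal.ofReal (f x ^ 2)) +
      Set.indicator {0}ᶜ (kernelInt N fun x y => (f x - f y) ^ 2) := by
    ext s
    by_cases hs : s = 0 <;> simp [gagSq, kernelInt, hs]
  rw [this]
  exact (aemeasurable_const.indicator (measurableSet_singleton 0)).add
    (h.indicator (measurableSet_singleton 0).compl)

lemma aemeasurable_interaction (hN : 1 ≤ N) {μm : Measure ℝ} {sb : ℝ} (hsb : sb ≤ 1)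
    (hf : Continuous f) (hg : Continuous g) :
    AEMeasurable (interaction N f g) (μm.restrict (Set.Ico 0 sb)) := by
  have h := aemeasurable_kernelInt hN (μm := μm) hsb
    (F := fun x y => 2 * (f x * g y + f y * g x)) (by fun_prop)
  have : interaction N f g = Set.indicator {0}ᶜ
      (kernelInt N fun x y => 2 * (f x * g y + f y * g x)) := by
    ext s
    by_cases hs : s = 0 <;> simp [interaction, hs]
  rw [this]
  exact h.indicator (measurableSet_singleton 0).compl

lemma interaction_const_mul (hf : Continuous f) (hg : Continuous g) {c : ℝ} (hc : 0 ≤ c) (s : ℝ) :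
    interaction N f (fun x => c * g x) s = ENNReal.ofReal c * interaction N f g s := by
  unfold interaction
  split_ifs
  · simp
  · rw [← kernelInt_const_mul (by fun_prop) hc]
    congr 1
    ext x y
    ring

lemma gagSq_sub_eq_add_interaction (hf : Continuous f) (hg : Continuous g) (hf0 : ∀ x, 0 ≤ f x)
    (hg0 : ∀ x, 0 ≤ g x) (hfg : ∀ x, f x * g x = 0) (s : ℝ) :
    gagSq N (fun x => f x - g x) s =
      gagSq N (fun x => f x + g x) s + 2 * interaction N f g s := by
  by_cases hs : s = 0
  · have h : ∀ x, (f x - g x) ^ 2 = (f x + g x) ^ 2 := fun x => by linear_combination -4 * hfg x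
    simp [gagSq, interaction, hs, h]
  · rw [gagSq_of_ne_zero hs, gagSq_of_ne_zero hs, interaction, if_neg hs]
    have h2 : (2 : ℝ≥0∞) = ENNReal.ofReal 2 := by simp
    rw [h2, ← kernelInt_const_mul (by fun_prop) zero_le_two, ← kernelInt_add (by fun_prop)]
    · congr 1
      ext x y
      linear_combination -4 * hfg x - 4 * hfg y
    · intros
      positivity
    · intro x y
      have := hf0 x
      have := hf0 y
      have := hg0 x
      have := hg0 y
      positivity

lemma gagSq_sub_eq_add_add_interaction (hf : Continuous f) (hg : Continuous g)
    (hf0 : ∀ x, 0 ≤ f x) (hg0 : ∀ x, 0 ≤ g x) (hfg : ∀ x, f x * g x = 0) (s : ℝ) :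
    gagSq N (fun x => f x - g x) s = gagSq N f s + gagSq N g s + interaction N f g s := by
  by_cases hs : s = 0
  · have h : ∀ x, (f x - g x) ^ 2 = f x ^ 2 + g x ^ 2 := fun x => by
      linear_combination -2 * hfg x
    simp only [gagSq, interaction, hs, h, if_true, add_zero]
    rw [← lintegral_add_left (by fun_prop)]
    refine lintegral_congr fun x => ?_
    rw [ENNReal.ofReal_add (by positivity) (by positivity)]
  · rw [gagSq_of_ne_zero hs, gagSq_of_ne_zero hs, gagSq_of_ne_zero hs, interaction, if_neg hs]
    rw [← kernelInt_add (by fun_prop), ← kernelInt_add (by fun_prop)]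
    · congr 1
      ext x y
      linear_combination -2 * hfg x - 2 * hfg y
    · intros
      positivity
    · intro x y
      have := hf0 x
      have := hf0 y
      have := hg0 x
      have := hg0 y
      positivity
    · intros
      positivity
    · intros
      positivity

lemma interaction_pos {s : ℝ} (hs : s ∈ Set.Ioo (0 : ℝ) 1) (hf : Continuous f)
    (hg : Continuous g) (hf0 : ∀ x, 0 ≤ f x) (hg0 : ∀ x, 0 ≤ g x) (hfg : ∀ x, f x * g x = 0)
    (hfp : ∃ x, 0 < f x) (hgp : ∃ x, 0 < g x) : 0 < interaction N f g s := by
  rw [interaction, if_neg hs.1.ne', kernelInt]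
  have hk := measurable_kernel (F := fun x y => 2 * (f x * g y + f y * g x)) (by fun_prop) s
  have hU : IsOpen {x | 0 < f x} := isOpen_lt continuous_const hf
  have hV : IsOpen {x | 0 < g x} := isOpen_lt continuous_const hg
  refine ENNReal.mul_pos (by simpa using cNs_pos hs) (ne_of_gt ?_)
  rw [lintegral_pos_iff_support hk.lintegral_prod_right']
  refine (hU.measure_pos volume hfp).trans_le (measure_mono fun x hx => ne_of_gt ?_)
  have hkx : Measurable fun y => ENNReal.ofReal
      (2 * (f x * g y + f y * g x) / ‖x - y‖ ^ ((N : ℝ) + 2 * s)) :=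
    hk.comp measurable_prodMk_left
  simp only
  rw [lintegral_pos_iff_support hkx]
  refine (hV.measure_pos volume hgp).trans_le (measure_mono fun y hy => ne_of_gt ?_)
  simp only [Set.mem_ofPred_eq] at hx hy
  have hxy : x ≠ y := by
    rintro rfl
    exact (mul_pos hx hy).ne' (hfg x)
  have h1 : 0 < ‖x - y‖ := norm_pos_iff.2 (sub_ne_zero.2 hxy)
  have h2 := mul_pos hx hy
  have h3 := mul_nonneg (hf0 y) (hg0 x)
  simp only [ENNReal.ofReal_pos]
  positivity

lemma lintegral_interaction_pos (hN : 1 ≤ N) {μm : Measure ℝ} {sb : ℝ} (hsb : sb ≤ 1)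
    (hμ : 0 < μm (Set.Ioo 0 sb)) (hf : Continuous f)
    (hg : Continuous g) (hf0 : ∀ x, 0 ≤ f x) (hg0 : ∀ x, 0 ≤ g x) (hfg : ∀ x, f x * g x = 0)
    (hfp : ∃ x, 0 < f x) (hgp : ∃ x, 0 < g x) :
    0 < ∫⁻ s in Set.Ico 0 sb, interaction N f g s ∂μm := by
  rw [pos_iff_ne_zero, Ne, lintegral_eq_zero_iff' (aemeasurable_interaction hN hsb hf hg)]
  intro h
  have h2 := ae_restrict_of_ae_restrict_of_subset (Set.Ioo_subset_Ico_self (a := 0) (b := sb)) h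
  replace h2 := (ae_restrict_iff' measurableSet_Ioo).1 h2
  refine hμ.ne' (measure_mono_null (fun s hs => ?_) h2)
  simp only [Set.mem_compl_iff, Set.mem_ofPred_eq]
  exact fun h3 => (interaction_pos ⟨hs.1, hs.2.trans_le hsb⟩ hf hg hf0 hg0 hfg hfp hgp).ne' (h3 hs)

lemma lintegral_interaction_lt_top (hN : 1 ≤ N) {μm : Measure ℝ} [IsFiniteMeasure μm] {sb : ℝ}
    (hsb : sb ≤ 1) {S : Set (EuclideanSpace ℝ (Fin N))} (hS : Bornology.IsBounded S) {C δ : ℝ}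
    (hfS : ∀ x ∉ S, f x = 0) (hgS : ∀ x ∉ S, g x = 0) (hf0 : ∀ x, 0 ≤ f x)
    (hg0 : ∀ x, 0 ≤ g x) (hfC : ∀ x, f x ≤ C) (hgC : ∀ x, g x ≤ C) (hδ : 0 < δ) (hδ1 : δ ≤ 1)
    (hsep : ∀ x y, f x * g y ≠ 0 → δ ≤ ‖x - y‖) :
    ∫⁻ s in Set.Ico 0 sb, interaction N f g s ∂μm < ⊤ := by
  obtain ⟨K, hK⟩ := isCompact_Icc.bddAbove_image (continuousOn_cNs hN)
  obtain ⟨R, hR⟩ := hS.subset_closedBall 0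
  set B := Metric.closedBall (0 : EuclideanSpace ℝ (Fin N)) R
  have hC : 0 ≤ C := (hf0 0).trans (hfC 0)
  have hprod : ∀ x y, f x * g y ≤ C * C := fun x y =>
    mul_le_mul (hfC x) (hgC y) (hg0 y) hC
  set P : ℝ := 2 * (C * C + C * C) / δ ^ ((N : ℝ) + 2) with hP
  have hpt : ∀ s ∈ Set.Ico 0 sb, ∀ x y,
      ENNReal.ofReal (2 * (f x * g y + f y * g x) / ‖x - y‖ ^ ((N : ℝ) + 2 * s)) ≤
        B.indicator (fun _ => B.indicator (fun _ => ENNReal.ofReal P) y) x := by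
    intro s hs x y
    by_cases h0 : f x * g y + f y * g x = 0
    · simp [h0]
    have hsupp : ∀ z, z ∉ B → f z = 0 ∧ g z = 0 := fun z hz =>
      ⟨hfS z fun h => hz (hR h), hgS z fun h => hz (hR h)⟩
    have hx : x ∈ B := by
      by_contra hx
      obtain ⟨h1, h2⟩ := hsupp x hx
      simp [h1, h2] at h0
    have hy : y ∈ B := by
      by_contra hy
      obtain ⟨h1, h2⟩ := hsupp y hy
      simp [h1, h2] at h0
    rw [Set.indicator_of_mem hx, Set.indicator_of_mem hy]
    apply ENNReal.ofReal_le_ofReal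
    have hd : δ ≤ ‖x - y‖ := by
      by_cases h1 : f x * g y = 0
      · rw [norm_sub_rev]
        exact hsep y x fun h2 => h0 (by rw [h1, h2, add_zero])
      · exact hsep x y h1
    have hpow : δ ^ ((N : ℝ) + 2) ≤ ‖x - y‖ ^ ((N : ℝ) + 2 * s) :=
      (Real.rpow_le_rpow_of_exponent_ge hδ hδ1 (by linarith [hs.2])).trans
        (Real.rpow_le_rpow hδ.le hd (by have := hs.1; positivity))
    have h1 := hprod x y
    have h2 := hprod y x
    have h3 := mul_nonneg (hf0 x) (hg0 y)
    have h4 := mul_nonneg (hf0 y) (hg0 x)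
    rw [hP]
    gcongr
  have hB : volume B < ⊤ := measure_closedBall_lt_top
  have hle : ∀ s ∈ Set.Ico 0 sb, interaction N f g s ≤
      ENNReal.ofReal K * (ENNReal.ofReal P * volume B * volume B) := by
    intro s hs
    unfold interaction
    split_ifs
    · exact zero_le
    · unfold kernelInt
      gcongr
      · exact hK ⟨s, ⟨hs.1, hs.2.le.trans hsb⟩, rfl⟩
      · calc _ ≤ ∫⁻ x, ∫⁻ y, B.indicator (fun _ => B.indicator (fun _ => ENNReal.ofReal P) y) x :=
            lintegral_mono fun x => lintegral_mono fun y => hpt s hs x y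
          _ = ∫⁻ x, B.indicator (fun _ => ENNReal.ofReal P * volume B) x := by
            refine lintegral_congr fun x => ?_
            by_cases hx : x ∈ B
            · simp only [hx, Set.indicator_of_mem]
              rw [lintegral_indicator_const Metric.isClosed_closedBall.measurableSet]
            · simp [hx]
          _ = _ := lintegral_indicator_const Metric.isClosed_closedBall.measurableSet _
  calc _ ≤ ∫⁻ s in Set.Ico 0 sb, ENNReal.ofReal K * (ENNReal.ofReal P * volume B * volume B) ∂μm :=
        setLIntegral_mono' measurableSet_Ico hle
    _ < ⊤ := by
      rw [setLIntegral_const]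
      refine ENNReal.mul_lt_top (ENNReal.mul_lt_top ENNReal.ofReal_lt_top
        (ENNReal.mul_lt_top (ENNReal.mul_lt_top ENNReal.ofReal_lt_top hB) hB)) (measure_lt_top _ _)

end KernelIntegrals

section TestFunctions

variable {N : ℕ} {f g : EuclideanSpace ℝ (Fin N) → ℝ}

lemma lintegral_comp_inv_smul_sub {r : ℝ} (hr : 0 < r) (b : EuclideanSpace ℝ (Fin N))
    (φ : EuclideanSpace ℝ (Fin N) → ℝ≥0∞) :
    ∫⁻ x, φ (r⁻¹ • (x - b)) = ENNReal.ofReal (r ^ N) * ∫⁻ x, φ x := by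
  rw [lintegral_sub_right_eq_self (fun x => φ (r⁻¹ • x)) b]
  have h := lintegral_map_equiv (μ := (volume : Measure (EuclideanSpace ℝ (Fin N)))) φ
    (MeasurableEquiv.smul₀ r⁻¹ (inv_ne_zero hr.ne'))
  simp only [MeasurableEquiv.coe_smul₀] at h
  rw [← h, Measure.map_addHaar_smul _ (inv_ne_zero hr.ne'), lintegral_smul_measure, smul_eq_mul]
  congr 2
  simp [abs_of_pos hr]

lemma gagSq_le_of_abs_sub_le {L : ℝ} (h : ∀ x y, |g x - g y| ≤ L * |f x - f y|)
    (h0 : ∀ x, |g x| ≤ L * |f x|) (s : ℝ) :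
    gagSq N g s ≤ ENNReal.ofReal (L ^ 2) * gagSq N f s := by
  have key : ∀ a b : ℝ, |a| ≤ L * |b| → a ^ 2 ≤ L ^ 2 * b ^ 2 := fun a b hab => by
    rw [← mul_pow, sq_le_sq, abs_mul]
    exact hab.trans (mul_le_mul_of_nonneg_right (le_abs_self L) (abs_nonneg b))
  by_cases hs : s = 0
  · simp only [gagSq, hs, if_true]
    rw [← lintegral_const_mul' _ _ ENNReal.ofReal_ne_top]
    refine lintegral_mono fun x => ?_
    rw [← ENNReal.ofReal_mul (sq_nonneg L)]
    exact ENNReal.ofReal_le_ofReal (key _ _ (h0 x))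
  · simp only [gagSq, hs, if_false]
    rw [mul_left_comm]
    gcongr
    rw [← lintegral_const_mul' _ _ ENNReal.ofReal_ne_top]
    refine lintegral_mono fun x => ?_
    rw [← lintegral_const_mul' _ _ ENNReal.ofReal_ne_top]
    refine lintegral_mono fun y => ?_
    rw [← ENNReal.ofReal_mul (sq_nonneg L), ← mul_div_assoc]
    apply ENNReal.ofReal_le_ofReal
    gcongr
    exact key _ _ (h x y)

lemma exists_gagSq_comp_inv_smul_sub_le (f : EuclideanSpace ℝ (Fin N) → ℝ) {r : ℝ} (hr : 0 < r)
    (hr1 : r ≤ 1) (b : EuclideanSpace ℝ (Fin N)) :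
    ∃ C : ℝ≥0∞, C ≠ ⊤ ∧ ∀ s ≤ 1,
      gagSq N (fun x => f (r⁻¹ • (x - b))) s ≤ C * gagSq N f s := by
  set A := ENNReal.ofReal (r ^ N) with hA
  set D := ENNReal.ofReal (r ^ ((N : ℝ) + 2))⁻¹ with hD
  have hAt : A ≠ ⊤ := ENNReal.ofReal_ne_top
  have hDt : D ≠ ⊤ := ENNReal.ofReal_ne_top
  refine ⟨A + D * (A * A), ENNReal.add_ne_top.2 ⟨hAt, ENNReal.mul_ne_top hDt
    (ENNReal.mul_ne_top hAt hAt)⟩, fun s hs => ?_⟩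
  rw [add_mul]
  by_cases h0 : s = 0
  · refine le_trans (le_of_eq ?_) le_self_add
    simp only [gagSq, h0, if_true]
    exact lintegral_comp_inv_smul_sub hr b fun x => ENNReal.ofReal (f x ^ 2)
  · refine le_trans ?_ le_add_self
    simp only [gagSq, h0, if_false]
    rw [mul_left_comm]
    gcongr
    set T : EuclideanSpace ℝ (Fin N) → EuclideanSpace ℝ (Fin N) → ℝ≥0∞ := fun x y =>
      D * ENNReal.ofReal ((f x - f y) ^ 2 / ‖x - y‖ ^ ((N : ℝ) + 2 * s)) with hT
    have hpt : ∀ x y, ENNReal.ofReal ((f (r⁻¹ • (x - b)) - f (r⁻¹ • (y - b))) ^ 2 /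
        ‖x - y‖ ^ ((N : ℝ) + 2 * s)) ≤ T (r⁻¹ • (x - b)) (r⁻¹ • (y - b)) := by
      intro x y
      have hn : ‖x - y‖ = r * ‖r⁻¹ • (x - b) - r⁻¹ • (y - b)‖ := by
        rw [← smul_sub, norm_smul, sub_sub_sub_cancel_right, Real.norm_eq_abs,
          abs_of_pos (inv_pos.2 hr), mul_inv_cancel_left₀ hr.ne']
      rw [hT, hn]
      simp only
      rw [hD, ← ENNReal.ofReal_mul (by positivity), Real.mul_rpow hr.le (norm_nonneg _),
        div_mul_eq_div_div_swap, div_eq_inv_mul _ (r ^ _)]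
      refine ENNReal.ofReal_le_ofReal (mul_le_mul_of_nonneg_right ?_ (by positivity))
      exact inv_anti₀ (Real.rpow_pos_of_pos hr _)
        (Real.rpow_le_rpow_of_exponent_ge hr hr1 (by linarith))
    calc _ ≤ ∫⁻ x, ∫⁻ y, T (r⁻¹ • (x - b)) (r⁻¹ • (y - b)) :=
          lintegral_mono fun x => lintegral_mono fun y => hpt x y
      _ = ∫⁻ x, A * ∫⁻ y, T (r⁻¹ • (x - b)) y :=
          lintegral_congr fun x => lintegral_comp_inv_smul_sub hr b (T (r⁻¹ • (x - b)))
      _ = A * ∫⁻ x, A * ∫⁻ y, T x y :=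
          lintegral_comp_inv_smul_sub hr b fun x => A * ∫⁻ y, T x y
      _ = _ := by
          rw [lintegral_const_mul' _ _ hAt, hT]
          simp only [lintegral_const_mul' _ _ hDt]
          ring

lemma exists_abs_le_of_eq_zero_off_bounded (hf : Continuous f)
    {S : Set (EuclideanSpace ℝ (Fin N))} (hS : Bornology.IsBounded S) (h : ∀ x ∉ S, f x = 0) :
    ∃ K, ∀ x, |f x| ≤ K := by
  have hsupp : HasCompactSupport f :=
    HasCompactSupport.intro hS.isCompact_closure fun x hx => h x fun hx' => hx (subset_closure hx')
  exact hsupp.exists_bound_of_continuous hf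

/-- A function of class `C¹` supported in a prescribed nonempty open set, obtained by truncating,
translating and shrinking `f`, and whose Gagliardo seminorms are controlled by those of `f`. -/
lemma exists_testFunction {U V : Set (EuclideanSpace ℝ (Fin N))} (hU : Bornology.IsBounded U)
    (hUo : IsOpen U) (hf : memA N U f) {p : EuclideanSpace ℝ (Fin N)} (hp : 0 < f p)
    (hV : IsOpen V) (hVne : V.Nonempty) :
    ∃ w : EuclideanSpace ℝ (Fin N) → ℝ, ContDiff ℝ 1 w ∧ (∀ x, 0 ≤ w x) ∧ (∃ x, 0 < w x) ∧
      (∀ x ∉ V, w x = 0) ∧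
      ∃ C : ℝ≥0∞, C ≠ ⊤ ∧ ∀ s ≤ 1, gagSq N w s ≤ C * gagSq N f s := by
  obtain ⟨hfc, hfd, hf0⟩ := hf
  obtain ⟨K, hK⟩ := exists_abs_le_of_eq_zero_off_bounded hfc hU hf0
  set φ : ℝ → ℝ := fun t => expNegInvGlue (t - f p / 2) with hφ
  have hφd : ContDiff ℝ 1 φ := by
    have h : ContDiff ℝ 1 expNegInvGlue := expNegInvGlue.contDiff (n := 1)
    exact h.comp (contDiff_id.sub contDiff_const)
  have hφz : ∀ t, t ≤ f p / 2 → φ t = 0 := fun t ht =>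
    expNegInvGlue.zero_of_nonpos (by linarith)
  obtain ⟨L, hL⟩ := hφd.contDiffOn.exists_lipschitzOnWith one_ne_zero
    (convex_Icc (-K) K) isCompact_Icc
  have hmem : ∀ x, f x ∈ Set.Icc (-K) K := fun x => abs_le.1 (hK x)
  have h0mem : (0 : ℝ) ∈ Set.Icc (-K) K := by
    have := (abs_nonneg _).trans (hK p)
    constructor <;> linarith
  set ψ : EuclideanSpace ℝ (Fin N) → ℝ := fun x => φ (f x) with hψ
  have hψd : ContDiff ℝ 1 ψ := by
    refine contDiff_iff_contDiffAt.2 fun x => ?_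
    by_cases hx : x ∈ U
    · exact hφd.contDiffAt.comp x (hfd.contDiffAt (hUo.mem_nhds hx))
    · have hlt : ∀ᶠ y in 𝓝 x, f y < f p / 2 :=
        hfc.continuousAt.eventually_lt continuousAt_const (by rw [hf0 x hx]; linarith)
      exact (contDiffAt_const (c := (0 : ℝ))).congr_of_eventuallyEq
        (hlt.mono fun y hy => hφz _ hy.le)
  have hψle : ∀ s, gagSq N ψ s ≤ ENNReal.ofReal ((L : ℝ) ^ 2) * gagSq N f s := by
    refine gagSq_le_of_abs_sub_le (fun x y => ?_) fun x => ?_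
    · simpa [Real.dist_eq] using hL.dist_le_mul _ (hmem x) _ (hmem y)
    · have := hL.dist_le_mul _ (hmem x) _ h0mem
      rwa [hφz 0 (by linarith), Real.dist_eq, Real.dist_eq, sub_zero, sub_zero] at this
  obtain ⟨b, hb⟩ := hVne
  obtain ⟨ρ, hρ, hball⟩ := Metric.isOpen_iff.1 hV b hb
  obtain ⟨R, hR0, hR⟩ := hU.subset_ball_lt 0 (0 : EuclideanSpace ℝ (Fin N))
  set r := min 1 (ρ / R) with hrdef
  have hr : 0 < r := lt_min one_pos (div_pos hρ hR0)
  have hr1 : r ≤ 1 := min_le_left _ _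
  have hrR : r * R ≤ ρ := (le_div_iff₀ hR0).1 (min_le_right _ _)
  obtain ⟨C, hC, hCle⟩ := exists_gagSq_comp_inv_smul_sub_le ψ hr hr1 b
  refine ⟨fun x => ψ (r⁻¹ • (x - b)), ?_, fun x => expNegInvGlue.nonneg _,
    ⟨b + r • p, ?_⟩, fun x hx => ?_, C * ENNReal.ofReal ((L : ℝ) ^ 2),
    ENNReal.mul_ne_top hC ENNReal.ofReal_ne_top, fun s hs => ?_⟩
  · have h : ContDiff ℝ 1 fun x => r⁻¹ • (x - b) := by fun_prop
    exact hψd.comp h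
  · simp only [add_sub_cancel_left, smul_smul, inv_mul_cancel₀ hr.ne', one_smul, hψ, hφ]
    exact expNegInvGlue.pos_of_pos (by linarith)
  · refine hφz _ ?_
    rw [hf0 _ fun h => hx (hball ?_)]
    · linarith
    have h1 := hR h
    rw [mem_ball_zero_iff, norm_smul, Real.norm_eq_abs, abs_of_pos (inv_pos.2 hr),
      inv_mul_lt_iff₀ hr] at h1
    rw [mem_ball_iff_norm]
    exact h1.trans_le hrR
  · rw [mul_assoc]
    exact (hCle s hs).trans (mul_le_mul_right (hψle s) C)

end TestFunctions

section Dirichlet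

variable {N : ℕ} {f g : EuclideanSpace ℝ (Fin N) → ℝ} {U : Set (EuclideanSpace ℝ (Fin N))}

lemma setIntegral_norm_fderiv_sq_pos (hN : 1 ≤ N) (hU : Bornology.IsBounded U) (hUo : IsOpen U)
    (hf : memA N U f) (hgrad : IntegrableOn (fun x => ‖fderiv ℝ f x‖ ^ 2) U)
    (hne : ∃ p, f p ≠ 0) : 0 < ∫ x in U, ‖fderiv ℝ f x‖ ^ 2 := by
  obtain ⟨hfc, hfd, hf0⟩ := hf
  obtain ⟨p, hp⟩ := hne
  refine (integral_nonneg fun x => by positivity).lt_of_ne' fun h0 => ?_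
  rw [integral_eq_zero_iff_of_nonneg (fun x => by positivity) hgrad] at h0
  have hcont : ContinuousOn (fun x => fderiv ℝ f x) U :=
    hfd.continuousOn_fderiv_of_isOpen hUo le_rfl
  have hzero : Set.EqOn (fun x => ‖fderiv ℝ f x‖ ^ 2) 0 U :=
    Measure.eqOn_open_of_ae_eq h0 hUo (hcont.norm.pow 2) continuousOn_const
  have hder : ∀ x ∈ U, fderiv ℝ f x = 0 := fun x hx => by simpa using hzero hx
  have hclopen : IsClopen {x | f x = f p} := by
    refine ⟨isClosed_eq hfc continuous_const, isOpen_iff_mem_nhds.2 fun x hx => ?_⟩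
    have hxU : x ∈ U := by
      by_contra h
      exact hp (by rw [← show f x = f p from hx, hf0 x h])
    obtain ⟨ρ, hρ, hball⟩ := Metric.isOpen_iff.1 hUo x hxU
    filter_upwards [Metric.ball_mem_nhds x hρ] with y hy
    refine Eq.trans ?_ (show f x = f p from hx)
    refine Metric.isOpen_ball.is_const_of_fderiv_eq_zero (𝕜 := ℝ)
      (convex_ball x ρ).isPreconnected ?_ (fun z hz => hder z (hball hz)) hy
      (Metric.mem_ball_self hρ)
    exact (hfd.differentiableOn one_ne_zero).mono hball
  have huniv := hclopen.eq_univ ⟨p, rfl⟩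
  have : Nonempty (Fin N) := ⟨⟨0, hN⟩⟩
  have hUuniv : U ≠ Set.univ := by
    rintro rfl
    exact NormedSpace.unbounded_univ ℝ (EuclideanSpace ℝ (Fin N)) hU
  obtain ⟨z, hz⟩ := (Set.ne_univ_iff_exists_notMem U).1 hUuniv
  have hzp : z ∈ {x | f x = f p} := by simp [huniv]
  exact hp (by rw [← show f z = f p from hzp, hf0 z hz])

lemma norm_fderiv_add_const_mul_sq {x : EuclideanSpace ℝ (Fin N)}
    (h : f =ᶠ[𝓝 x] (fun _ => 0) ∨ g =ᶠ[𝓝 x] (fun _ => 0)) (c : ℝ) :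
    ‖fderiv ℝ (fun y => f y + c * g y) x‖ ^ 2 =
      ‖fderiv ℝ f x‖ ^ 2 + c ^ 2 * ‖fderiv ℝ g x‖ ^ 2 := by
  rcases h with h | h
  · have h1 : (fun y => f y + c * g y) =ᶠ[𝓝 x] c • g := by
      filter_upwards [h] with y hy
      simp [hy]
    rw [h1.fderiv_eq, h.fderiv_eq, fderiv_const_smul_field]
    simp [norm_smul, mul_pow]
  · have h1 : (fun y => f y + c * g y) =ᶠ[𝓝 x] f := by
      filter_upwards [h] with y hy
      simp [hy]
    rw [h1.fderiv_eq, h.fderiv_eq]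
    simp

lemma memA.add_const_mul (hf : memA N U f) (hg : memA N U g) (c : ℝ) :
    memA N U fun x => f x + c * g x :=
  ⟨hf.1.add (continuous_const.mul hg.1), hf.2.1.add (contDiffOn_const.mul hg.2.1),
    fun x hx => by simp [hf.2.2 x hx, hg.2.2 x hx]⟩

lemma memA.neg (hf : memA N U f) : memA N U (-f) :=
  ⟨hf.1.neg, hf.2.1.neg, fun x hx => by simp [hf.2.2 x hx]⟩

variable {μm : Measure ℝ} {sb : ℝ}

lemma exists_ne_zero_of_denom_pos (h : 0 < denom N μm sb f) : ∃ p, f p ≠ 0 := by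
  by_contra! h0
  have : f = fun _ => 0 := funext h0
  simp [denom, this, gagSq_zero_fun] at h

lemma admissible.neg (h : admissible N μm sb U f) : admissible N μm sb U (-f) := by
  obtain ⟨h1, h2, h3⟩ := h
  refine ⟨h1.neg, ?_, by rwa [denom_neg]⟩
  simpa only [fderiv_neg, norm_neg] using h2

lemma rayleigh_neg : rayleigh N μm sb U (-f) = rayleigh N μm sb U f := by
  simp only [rayleigh, denom_neg, fderiv_neg, norm_neg]

lemma denom_sub_eq_add_interaction (hN : 1 ≤ N) (hsb : sb ≤ 1) (hf : Continuous f)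
    (hg : Continuous g) (hf0 : ∀ x, 0 ≤ f x) (hg0 : ∀ x, 0 ≤ g x) (hfg : ∀ x, f x * g x = 0) :
    denom N μm sb (fun x => f x - g x) = denom N μm sb (fun x => f x + g x) +
      2 * ∫⁻ s in Set.Ico 0 sb, interaction N f g s ∂μm := by
  simp only [denom, gagSq_sub_eq_add_interaction hf hg hf0 hg0 hfg]
  have h : Continuous fun x => f x + g x := hf.add hg
  rw [lintegral_add_left' (aemeasurable_gagSq hN hsb h),
    lintegral_const_mul' _ _ ENNReal.ofNat_ne_top]

lemma denom_sub_eq_add_add_interaction (hN : 1 ≤ N) (hsb : sb ≤ 1) (hf : Continuous f)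
    (hg : Continuous g) (hf0 : ∀ x, 0 ≤ f x) (hg0 : ∀ x, 0 ≤ g x) (hfg : ∀ x, f x * g x = 0) :
    denom N μm sb (fun x => f x - g x) = denom N μm sb f + denom N μm sb g +
      ∫⁻ s in Set.Ico 0 sb, interaction N f g s ∂μm := by
  simp only [denom, gagSq_sub_eq_add_add_interaction hf hg hf0 hg0 hfg]
  have h1 := aemeasurable_gagSq hN (μm := μm) hsb hf
  have h2 := aemeasurable_gagSq hN (μm := μm) hsb hg
  have h3 : AEMeasurable (fun s => gagSq N f s + gagSq N g s) (μm.restrict (Set.Ico 0 sb)) :=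
    h1.add h2
  rw [lintegral_add_left' h3, lintegral_add_left' h1]

end Dirichlet

section Perturbation

variable {N : ℕ} {u : EuclideanSpace ℝ (Fin N) → ℝ} {V W : Set (EuclideanSpace ℝ (Fin N))}
  {μm : Measure ℝ} {sb : ℝ}

lemma exists_le_norm_sub_of_disjoint_closure (hV : Bornology.IsBounded V)
    (h : Disjoint (closure V) (closure W)) :
    ∃ δ : ℝ, 0 < δ ∧ δ ≤ 1 ∧ ∀ x ∈ W, ∀ y ∈ V, δ ≤ ‖x - y‖ := by
  obtain ⟨r, hr, hlt⟩ := Metric.exists_pos_forall_lt_edist hV.isCompact_closure isClosed_closure h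
  refine ⟨min r 1, lt_min hr one_pos, min_le_right _ _, fun x hx y hy => (min_le_left _ _).trans ?_⟩
  have := hlt y (subset_closure hy) x (subset_closure hx)
  rw [edist_nndist, ENNReal.coe_lt_coe] at this
  rw [← dist_eq_norm, dist_comm]
  exact_mod_cast this.le

/-- Reversing the sign of a nonnegative function on one of two separated pieces of its support
lowers the Rayleigh quotient. -/
lemma exists_rayleigh_lt_of_pos_of_pos [IsFiniteMeasure μm] (hN : 1 ≤ N) (hsb : sb ≤ 1)
    (hμ : 0 < μm (Set.Ioo 0 sb)) (hVo : IsOpen V) (hWo : IsOpen W)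
    (hV : Bornology.IsBounded V) (hW : Bornology.IsBounded W)
    (hVW : Disjoint (closure V) (closure W)) (hu : admissible N μm sb (V ∪ W) u)
    (hu0 : ∀ x, 0 ≤ u x) (hpV : ∃ x ∈ V, 0 < u x) (hpW : ∃ x ∈ W, 0 < u x) :
    ∃ v, admissible N μm sb (V ∪ W) v ∧
      rayleigh N μm sb (V ∪ W) v < rayleigh N μm sb (V ∪ W) u := by
  classical
  obtain ⟨hA, hgrad, hD0, hDt⟩ := hu
  have hdisj : ∀ x ∈ V, x ∉ W := fun x hx hx' =>
    Set.disjoint_left.1 hVW (subset_closure hx) (subset_closure hx')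
  obtain ⟨δ, hδ, hδ1, hsep⟩ := exists_le_norm_sub_of_disjoint_closure hV hVW
  obtain ⟨C, hC⟩ := exists_abs_le_of_eq_zero_off_bounded hA.1 (hV.union hW) hA.2.2
  set g : EuclideanSpace ℝ (Fin N) → ℝ := V.indicator u with hg
  set f : EuclideanSpace ℝ (Fin N) → ℝ := Vᶜ.indicator u with hf
  have hfV : ∀ x ∈ V, f x = 0 := fun x hx => by simp [hf, hx]
  have hgV : ∀ x ∉ V, g x = 0 := fun x hx => by simp [hg, hx]
  have hgV' : ∀ x ∈ V, g x = u x := fun x hx => by simp [hg, hx]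
  have hfV' : ∀ x ∉ V, f x = u x := fun x hx => by simp [hf, hx]
  have hfW : ∀ x ∉ W, f x = 0 := fun x hx => by
    by_cases hxV : x ∈ V
    · exact hfV x hxV
    · rw [hfV' x hxV]
      exact hA.2.2 x (by simp [hx, hxV])
  have hsum : u = fun x => f x + g x := by
    ext x
    by_cases hx : x ∈ V <;> simp [hf, hg, hx]
  have hfeq : f = fun x => u x + (-1) * g x := by
    ext x
    rw [congrFun hsum x]
    ring
  have hf0 : ∀ x, 0 ≤ f x := fun x => Set.indicator_nonneg (fun y _ => hu0 y) x
  have hg0 : ∀ x, 0 ≤ g x := fun x => Set.indicator_nonneg (fun y _ => hu0 y) x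
  have hfg : ∀ x, f x * g x = 0 := fun x => by
    by_cases hx : x ∈ V <;> simp [hf, hg, hx]
  have hgA : memA N (V ∪ W) g := by
    refine ⟨continuous_indicator (fun x hx => hA.2.2 x ?_) hA.1.continuousOn, ?_,
      fun x hx => hgV x fun h => hx (Or.inl h)⟩
    · rw [hVo.frontier_eq] at hx
      rintro (h | h)
      · exact hx.2 h
      · exact Set.disjoint_left.1 hVW hx.1 (subset_closure h)
    · rintro x (hx | hx)
      · refine ((hA.2.1.contDiffAt ((hVo.union hWo).mem_nhds (Or.inl hx))).congr_of_eventuallyEq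
          ?_).contDiffWithinAt
        filter_upwards [hVo.mem_nhds hx] with y hy using hgV' y hy
      · refine ((contDiffAt_const (c := (0 : ℝ))).congr_of_eventuallyEq ?_).contDiffWithinAt
        filter_upwards [hWo.mem_nhds hx] with y hy using hgV y fun h => hdisj y h hy
  have hfA : memA N (V ∪ W) f := by
    rw [hfeq]
    exact hA.add_const_mul hgA (-1)
  have hlocal : ∀ x ∈ V ∪ W, f =ᶠ[𝓝 x] (fun _ => 0) ∨ g =ᶠ[𝓝 x] (fun _ => 0) := by
    rintro x (hx | hx)
    · exact Or.inl (by filter_upwards [hVo.mem_nhds hx] with y hy using hfV y hy)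
    · exact Or.inr (by
        filter_upwards [hWo.mem_nhds hx] with y hy using hgV y fun h => hdisj y h hy)
  have hderiv : Set.EqOn (fun x => ‖fderiv ℝ (fun x => f x - g x) x‖ ^ 2)
      (fun x => ‖fderiv ℝ u x‖ ^ 2) (V ∪ W) := by
    intro x hx
    have h1 := norm_fderiv_add_const_mul_sq (hlocal x hx) 1
    have h2 := norm_fderiv_add_const_mul_sq (hlocal x hx) (-1)
    simp only [one_mul, neg_one_mul, ← sub_eq_add_neg] at h1 h2
    simp only
    rw [h2, hsum, h1]
    ring
  set J := ∫⁻ s in Set.Ico 0 sb, interaction N f g s ∂μm with hJ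
  have hfC : ∀ x, f x ≤ C := fun x => by
    have h1 := (le_abs_self _).trans (hC x)
    have h2 := hg0 x
    rw [congrFun hsum x] at h1
    linarith
  have hgC : ∀ x, g x ≤ C := fun x => by
    have h1 := (le_abs_self _).trans (hC x)
    have h2 := hf0 x
    rw [congrFun hsum x] at h1
    linarith
  have hJt : J < ⊤ := by
    refine lintegral_interaction_lt_top hN hsb (hV.union hW) hfA.2.2 hgA.2.2 hf0 hg0 hfC hgC
      hδ hδ1 fun x y hxy => hsep x ?_ y ?_
    · by_contra h
      simp [hfW x h] at hxy
    · by_contra h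
      simp [hgV y h] at hxy
  obtain ⟨p, hpV, hp⟩ := hpV
  obtain ⟨q, hqW, hq⟩ := hpW
  have hJ0 : 0 < J := by
    refine lintegral_interaction_pos hN hsb hμ hfA.1 hgA.1 hf0 hg0 hfg ⟨q, ?_⟩ ⟨p, ?_⟩
    · rwa [hfV' q fun h => hdisj q h hqW]
    · rwa [hgV' p hpV]
  have hden := denom_sub_eq_add_interaction hN hsb (μm := μm) hfA.1 hgA.1 hf0 hg0 hfg
  rw [← hsum] at hden
  have hmeas : MeasurableSet (V ∪ W) := (hVo.union hWo).measurableSet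
  have h2J : 2 * J ≠ ⊤ := ENNReal.mul_ne_top ENNReal.ofNat_ne_top hJt.ne
  refine ⟨fun x => f x - g x, ⟨?_, hgrad.congr_fun hderiv.symm hmeas, ?_, ?_⟩, ?_⟩
  · simpa only [neg_one_mul, ← sub_eq_add_neg] using hfA.add_const_mul hgA (-1)
  · rw [hden]
    exact hD0.trans_le le_self_add
  · rw [hden]
    exact ENNReal.add_lt_top.2 ⟨hDt, h2J.lt_top⟩
  · unfold rayleigh
    rw [setIntegral_congr_fun hmeas hderiv, hden, ENNReal.toReal_add hDt.ne h2J]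
    refine div_lt_div_of_pos_left (setIntegral_norm_fderiv_sq_pos hN (hV.union hW)
      (hVo.union hWo) hA hgrad ⟨p, hp.ne'⟩) (ENNReal.toReal_pos hD0.ne' hDt.ne) ?_
    exact lt_add_of_pos_right _ (ENNReal.toReal_pos (by simpa using hJ0.ne') h2J)

/-- If a nonnegative function vanishes on `V`, subtracting a small nonnegative bump supported in `V`
lowers the Rayleigh quotient. -/
lemma exists_rayleigh_lt_of_eq_zero [IsFiniteMeasure μm] (hN : 1 ≤ N) (hsb : sb ≤ 1)
    (hμ : 0 < μm (Set.Ioo 0 sb)) (hVo : IsOpen V) (hWo : IsOpen W)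
    (hV : Bornology.IsBounded V) (hW : Bornology.IsBounded W)
    (hVW : Disjoint (closure V) (closure W)) (hVne : V.Nonempty)
    (hu : admissible N μm sb (V ∪ W) u)
    (hu0 : ∀ x, 0 ≤ u x) (huV : ∀ x ∈ V, u x = 0) (hp : ∃ x, 0 < u x) :
    ∃ v, admissible N μm sb (V ∪ W) v ∧
      rayleigh N μm sb (V ∪ W) v < rayleigh N μm sb (V ∪ W) u := by
  obtain ⟨hA, hgrad, hD0, hDt⟩ := hu
  have hdisj : ∀ x ∈ V, x ∉ W := fun x hx hx' =>
    Set.disjoint_left.1 hVW (subset_closure hx) (subset_closure hx')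
  have hUo := hVo.union hWo
  have hU := hV.union hW
  have hmeas : MeasurableSet (V ∪ W) := hUo.measurableSet
  obtain ⟨δ, hδ, hδ1, hsep⟩ := exists_le_norm_sub_of_disjoint_closure hV hVW
  obtain ⟨p, hp⟩ := hp
  obtain ⟨w, hwd, hw0, hwp, hwV, K, hK, hwK⟩ := exists_testFunction hU hUo hA hp hVo hVne
  have hwA : memA N (V ∪ W) w :=
    ⟨hwd.continuous, hwd.contDiffOn, fun x hx => hwV x fun h => hx (Or.inl h)⟩
  obtain ⟨C₁, hC₁⟩ := exists_abs_le_of_eq_zero_off_bounded hA.1 hU hA.2.2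
  obtain ⟨C₂, hC₂⟩ := exists_abs_le_of_eq_zero_off_bounded hwA.1 hU hwA.2.2
  have huw : ∀ x, u x * w x = 0 := fun x => by
    by_cases hx : x ∈ V
    · simp [huV x hx]
    · simp [hwV x hx]
  have huW : ∀ x ∉ W, u x = 0 := fun x hx => by
    by_cases hxV : x ∈ V
    · exact huV x hxV
    · exact hA.2.2 x (by simp [hx, hxV])
  have hlocal : ∀ x ∈ V ∪ W, u =ᶠ[𝓝 x] (fun _ => 0) ∨ w =ᶠ[𝓝 x] (fun _ => 0) := by
    rintro x (hx | hx)
    · exact Or.inl (by filter_upwards [hVo.mem_nhds hx] with y hy using huV y hy)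
    · exact Or.inr (by
        filter_upwards [hWo.mem_nhds hx] with y hy using hwV y fun h => hdisj y h hy)
  set J := ∫⁻ s in Set.Ico 0 sb, interaction N u w s ∂μm with hJ
  have hJt : J < ⊤ := by
    refine lintegral_interaction_lt_top (C := max C₁ C₂) hN hsb hU hA.2.2 hwA.2.2 hu0 hw0
      (fun x => ((le_abs_self _).trans (hC₁ x)).trans (le_max_left _ _))
      (fun x => ((le_abs_self _).trans (hC₂ x)).trans (le_max_right _ _))
      hδ hδ1 fun x y hxy => hsep x ?_ y ?_
    · by_contra h
      simp [huW x h] at hxy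
    · by_contra h
      simp [hwV y h] at hxy
  have hJ0 : 0 < J := lintegral_interaction_pos hN hsb hμ hA.1 hwA.1 hu0 hw0 huw ⟨p, hp⟩ hwp
  have hwint : IntegrableOn (fun x => ‖fderiv ℝ w x‖ ^ 2) (V ∪ W) := by
    have hc : Continuous fun x => ‖fderiv ℝ w x‖ ^ 2 :=
      (hwd.continuous_fderiv one_ne_zero).norm.pow 2
    exact (hc.continuousOn.integrableOn_compact hU.isCompact_closure).mono_set subset_closure
  set A := ∫ x in V ∪ W, ‖fderiv ℝ u x‖ ^ 2 with hAdef
  set B := ∫ x in V ∪ W, ‖fderiv ℝ w x‖ ^ 2 with hBdef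
  have hApos : 0 < A := setIntegral_norm_fderiv_sq_pos hN hU hUo hA hgrad ⟨p, hp.ne'⟩
  have hB0 : 0 ≤ B := integral_nonneg fun x => by positivity
  set D := (denom N μm sb u).toReal with hD
  have hDpos : 0 < D := ENNReal.toReal_pos hD0.ne' hDt.ne
  have hJpos : 0 < J.toReal := ENNReal.toReal_pos hJ0.ne' hJt.ne
  set ε := A * J.toReal / (D * (B + 1)) with hε
  have hεpos : 0 < ε := by positivity
  have hεlt : ε * B * D < A * J.toReal := by
    rw [hε, div_mul_eq_mul_div, div_mul_eq_mul_div, div_lt_iff₀ (by positivity)]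
    have := mul_pos (mul_pos hApos hJpos) hDpos
    nlinarith
  have hεA := hA.add_const_mul hwA (-ε)
  have hveq : (fun x => u x + -ε * w x) = fun x => u x - ε * w x := by
    ext x
    ring
  have hderiv : Set.EqOn (fun x => ‖fderiv ℝ u x‖ ^ 2 + ε ^ 2 * ‖fderiv ℝ w x‖ ^ 2)
      (fun x => ‖fderiv ℝ (fun x => u x - ε * w x) x‖ ^ 2) (V ∪ W) := by
    intro x hx
    have h2 := norm_fderiv_add_const_mul_sq (hlocal x hx) (-ε)
    rw [hveq] at h2
    simp only
    rw [h2]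
    ring
  have hden := denom_sub_eq_add_add_interaction hN hsb (μm := μm) (g := fun x => ε * w x) hA.1
    (continuous_const.mul hwA.1) hu0 (fun x => mul_nonneg hεpos.le (hw0 x))
    fun x => by linear_combination ε * huw x
  simp only [interaction_const_mul hA.1 hwA.1 hεpos.le] at hden
  rw [lintegral_const_mul' _ _ ENNReal.ofReal_ne_top, ← hJ] at hden
  set Q := denom N μm sb (fun x => ε * w x) with hQ
  have hQt : Q < ⊤ := by
    have hle : ∀ s ∈ Set.Ico 0 sb, gagSq N (fun x => ε * w x) s ≤
        ENNReal.ofReal (ε ^ 2) * K * gagSq N u s := by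
      intro s hs
      refine (gagSq_le_of_abs_sub_le (f := w) (L := ε) (fun x y => ?_) (fun x => ?_) s).trans ?_
      · rw [← mul_sub, abs_mul, abs_of_pos hεpos]
      · rw [abs_mul, abs_of_pos hεpos]
      · rw [mul_assoc]
        exact mul_le_mul_right (hwK s (hs.2.le.trans hsb)) _
    have hKt : ENNReal.ofReal (ε ^ 2) * K ≠ ⊤ := ENNReal.mul_ne_top ENNReal.ofReal_ne_top hK
    refine (setLIntegral_mono' measurableSet_Ico hle).trans_lt ?_
    rw [lintegral_const_mul' _ _ hKt]
    exact ENNReal.mul_lt_top hKt.lt_top hDt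
  have hεJ : ENNReal.ofReal ε * J ≠ ⊤ := ENNReal.mul_ne_top ENNReal.ofReal_ne_top hJt.ne
  have hDQ : denom N μm sb u + Q ≠ ⊤ := ENNReal.add_ne_top.2 ⟨hDt.ne, hQt.ne⟩
  refine ⟨fun x => u x - ε * w x, ⟨?_,
    (hgrad.add (hwint.const_mul (ε ^ 2))).congr_fun hderiv hmeas, ?_, ?_⟩, ?_⟩
  · rwa [← hveq]
  · rw [hden, add_assoc]
    exact hD0.trans_le le_self_add
  · rw [hden]
    exact ENNReal.add_lt_top.2 ⟨hDQ.lt_top, hεJ.lt_top⟩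
  · unfold rayleigh
    rw [← setIntegral_congr_fun hmeas hderiv, hden, ENNReal.toReal_add hDQ hεJ,
      ENNReal.toReal_add hDt.ne hQt.ne, integral_add hgrad (hwint.const_mul (ε ^ 2)),
      integral_const_mul, ENNReal.toReal_mul, ENNReal.toReal_ofReal hεpos.le,
      ← hAdef, ← hBdef, ← hD]
    have hQ0 : 0 ≤ Q.toReal := ENNReal.toReal_nonneg
    rw [div_lt_div_iff₀ (by positivity) hDpos]
    have h1 := mul_lt_mul_of_pos_left hεlt hεpos
    have h2 := mul_nonneg hApos.le hQ0
    nlinarith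

lemma exists_rayleigh_lt_of_nonneg [IsFiniteMeasure μm] (hN : 1 ≤ N) {M : ℕ} (hM : 2 ≤ M)
    {Ω : Fin M → Set (EuclideanSpace ℝ (Fin N))}
    (hne : ∀ j, (Ω j).Nonempty) (ho : ∀ j, IsOpen (Ω j))
    (hb : ∀ j, Bornology.IsBounded (Ω j))
    (hdisj : ∀ i j, i ≠ j → Disjoint (closure (Ω i)) (closure (Ω j)))
    (hsb : sb ≤ 1) (hμ : 0 < μm (Set.Ioo 0 sb))
    (hu : admissible N μm sb (⋃ j, Ω j) u) (hu0 : ∀ x, 0 ≤ u x) :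
    ∃ v, admissible N μm sb (⋃ j, Ω j) v ∧
      rayleigh N μm sb (⋃ j, Ω j) v < rayleigh N μm sb (⋃ j, Ω j) u := by
  obtain ⟨p, hp⟩ := exists_ne_zero_of_denom_pos hu.2.2.1
  have hpU : p ∈ ⋃ j, Ω j := by
    by_contra h
    exact hp (hu.1.2.2 p h)
  obtain ⟨i, hpi⟩ := Set.mem_iUnion.1 hpU
  have hpos : 0 < u p := (hu0 p).lt_of_ne' hp
  have : Nontrivial (Fin M) := Fin.nontrivial_iff_two_le.2 hM
  obtain ⟨j, hji⟩ := exists_ne i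
  set W := ⋃ k : {k // k ≠ j}, Ω k with hW
  have hpW : p ∈ W := Set.mem_iUnion.2 ⟨⟨i, hji.symm⟩, hpi⟩
  have hU : ⋃ k, Ω k = Ω j ∪ W := by
    ext x
    simp only [hW, Set.mem_iUnion, Set.mem_union, Subtype.exists, exists_prop]
    constructor
    · rintro ⟨k, hk⟩
      by_cases h : k = j
      · exact Or.inl (h ▸ hk)
      · exact Or.inr ⟨k, h, hk⟩
    · rintro (h | ⟨k, -, hk⟩)
      · exact ⟨j, h⟩
      · exact ⟨k, hk⟩
  have hWo : IsOpen W := isOpen_iUnion fun k => ho k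
  have hWb : Bornology.IsBounded W := Bornology.isBounded_iUnion.2 fun k => hb k
  have hVW : Disjoint (closure (Ω j)) (closure W) := by
    rw [hW, closure_iUnion_of_finite, Set.disjoint_iUnion_right]
    exact fun k => hdisj j k k.2.symm
  rw [hU] at hu ⊢
  by_cases h : ∃ x ∈ Ω j, 0 < u x
  · exact exists_rayleigh_lt_of_pos_of_pos hN hsb hμ (ho j) hWo (hb j) hWb hVW hu hu0 h
      ⟨p, hpW, hpos⟩
  · push Not at h
    exact exists_rayleigh_lt_of_eq_zero hN hsb hμ (ho j) hWo (hb j) hWb hVW (hne j) hu hu0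
      (fun x hx => (h x hx).antisymm (hu0 x)) ⟨p, hpos⟩

end Perturbation

theorem stmt1 (N M : ℕ) (hN : 1 ≤ N) (hM : 2 ≤ M)
    (Ω : Fin M → Set (EuclideanSpace ℝ (Fin N)))
    (hne : ∀ j, (Ω j).Nonempty) (ho : ∀ j, IsOpen (Ω j))
    (hb : ∀ j, Bornology.IsBounded (Ω j))
    (hdisj : ∀ i j, i ≠ j → Disjoint (closure (Ω i)) (closure (Ω j)))
    (μm : Measure ℝ) [IsFiniteMeasure μm] (hμmsupp : μm (Set.Icc 0 1)ᶜ = 0)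
    (sb : ℝ) (hsb : sb ∈ Set.Ioo (0 : ℝ) 1)
    (hμmpos : 0 < μm (Set.Ioo 0 sb)) (hμmsb : μm (Set.Icc sb 1) = 0)
    (u : EuclideanSpace ℝ (Fin N) → ℝ)
    (hadm : admissible N μm sb (⋃ j, Ω j) u)
    (hmin : ∀ v, admissible N μm sb (⋃ j, Ω j) v →
      rayleigh N μm sb (⋃ j, Ω j) u ≤ rayleigh N μm sb (⋃ j, Ω j) v) :
    (∃ x, 0 < u x) ∧ (∃ x, u x < 0) := by
  constructor
  · by_contra! h
    obtain ⟨v, hv, hlt⟩ := exists_rayleigh_lt_of_nonneg hN hM hne ho hb hdisj hsb.2.le hμmpos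
      hadm.neg fun x => by simpa using h x
    rw [rayleigh_neg] at hlt
    exact (hmin v hv).not_gt hlt
  · by_contra! h
    obtain ⟨v, hv, hlt⟩ := exists_rayleigh_lt_of_nonneg hN hM hne ho hb hdisj hsb.2.le hμmpos
      hadm h
    exact (hmin v hv).not_gt hlt
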